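/- For every multi-index k ∈ ℕ^d, the function x ↦ 2^{|k|/2} · (R_1^{k_1} ∘ ⋯ ∘ R_d^{k_d} φ₀)(x) / φ₀(x) on ℝ^d is a polynomial of degree |k| with complex coefficients (in particular, the ratio is independent of the choice of branch of the square root in φ₀). -/

import Mathlib

open Matrix Complex

noncomputable section

/-- The pairing `⟨a, b⟩ = ∑ j, conj (a j) * b j` on `ℂ^d`. -/
def cinner {d : ℕ} (a b : Fin d → ℂ) : ℂ := ∑ j, (starRingEnd ℂ) (a j) * b j

/-- The embedding of `ℝ^d` into `ℂ^d`. -/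
def cvec {d : ℕ} (x : Fin d → ℝ) : Fin d → ℂ := fun j => (x j : ℂ)

/-- The `l`-th standard basis vector of `ℂ^d`. -/
def stdC {d : ℕ} (l : Fin d) : Fin d → ℂ := Pi.single l 1

/-- The gradient of `ψ : ℝ^d → ℂ`, viewed as the vector of partial derivatives. -/
def grad {d : ℕ} (ψ : (Fin d → ℝ) → ℂ) (x : Fin d → ℝ) : Fin d → ℂ :=
  fun j => fderiv ℝ ψ x (Pi.single j 1)

/-- The raising operator `R_l` built from `(A, B)` at semiclassical parameter `h`. -/
def raiseOp {d : ℕ} (A B : Matrix (Fin d) (Fin d) ℂ) (h : ℝ) (l : Fin d)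
    (ψ : (Fin d → ℝ) → ℂ) : (Fin d → ℝ) → ℂ := fun x =>
  ((Real.sqrt (2 * h) : ℝ) : ℂ)⁻¹ *
    (cinner (B.mulVec (stdC l)) (cvec x) * ψ x
      - (h : ℂ) * cinner (A.mulVec (stdC l)) (grad ψ x))

/-- The ground state Gaussian `φ₀`, where `sqrtA` is a fixed branch of `√(det A)`. -/
def phi0 {d : ℕ} (A B : Matrix (Fin d) (Fin d) ℂ) (h : ℝ) (sqrtA : ℂ)
    (x : Fin d → ℝ) : ℂ :=
  ((Real.pi ^ (-(d : ℝ) / 4) * h ^ (-(d : ℝ) / 4) : ℝ) : ℂ) * sqrtA⁻¹ *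
    Complex.exp (-(cinner (cvec x) ((B * A⁻¹).mulVec (cvec x)) / ((2 * h : ℝ) : ℂ)))

/-- `R_1^{k_1} ∘ ⋯ ∘ R_d^{k_d}` for a family of operators `R` and a multi-index `k`. -/
def opPow {d : ℕ} {α : Type*} (R : Fin d → (α → α)) (k : Fin d → ℕ) : α → α :=
  (List.finRange d).foldr (fun l f => (R l)^[k l] ∘ f) id

/-- The polynomials `P_k(A, h, x)`:
`P_k = 2^{|k|/2} (R_1^{k_1} ∘ ⋯ ∘ R_d^{k_d} φ₀)(x) / φ₀(x)`. -/
def Ppoly {d : ℕ} (A B : Matrix (Fin d) (Fin d) ℂ) (h : ℝ) (sqrtA : ℂ)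
    (k : Fin d → ℕ) (x : Fin d → ℝ) : ℂ :=
  (((2 : ℝ) ^ (((∑ l, k l : ℕ) : ℝ) / 2) : ℝ) : ℂ) *
    opPow (raiseOp A B h) k (phi0 A B h sqrtA) x / phi0 A B h sqrtA x

/-- The coordinate partial derivative `∂_j` acting on functions on `ℝ^d`. -/
def pdC {d : ℕ} (j : Fin d) (f : (Fin d → ℝ) → ℂ) : (Fin d → ℝ) → ℂ :=
  fun x => fderiv ℝ f x (Pi.single j 1)

/-- The generating function
`G(x,z) = exp(−⟨conj z, A⁻¹ conj(A) z⟩ + (2/√h) ⟨conj z, A⁻¹ x⟩)`. -/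
def Gfun {d : ℕ} (A : Matrix (Fin d) (Fin d) ℂ) (h : ℝ) (x : Fin d → ℝ)
    (z : Fin d → ℂ) : ℂ :=
  Complex.exp
    (-(cinner (fun j => (starRingEnd ℂ) (z j)) ((A⁻¹ * A.map (starRingEnd ℂ)).mulVec z))
      + (2 / ((Real.sqrt h : ℝ) : ℂ)) *
          cinner (fun j => (starRingEnd ℂ) (z j)) (A⁻¹.mulVec (cvec x)))

/-- The holomorphic partial derivative `∂/∂z_l` of a function on `ℂ^d`. -/
def dz {d : ℕ} (l : Fin d) (f : (Fin d → ℂ) → ℂ) : (Fin d → ℂ) → ℂ :=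
  fun z => deriv (fun t => f (Function.update z l t)) (z l)


open MvPolynomial in
theorem hasFDerivAt_eval_cvec {d : ℕ} (Q : MvPolynomial (Fin d) ℂ) (x : Fin d → ℝ) :
    HasFDerivAt (fun y : Fin d → ℝ => eval (cvec y) Q)
      (∑ j, eval (cvec x) (pderiv j Q) •
        (ofRealCLM.comp (ContinuousLinearMap.proj (R := ℝ) (φ := fun _ : Fin d => ℝ) j))) x := by
  induction Q using MvPolynomial.induction_on with
  | C a =>
    simp only [eval_C]
    exact (hasFDerivAt_const (𝕜 := ℝ) a x).congr_fderiv (by ext v; simp)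
  | add p q hp hq => 
    simp only [map_add]
    exact (hp.add hq).congr_fderiv (by ext v; simp [add_mul, Finset.sum_add_distrib])
  | mul_X p i hp =>
    have hX : HasFDerivAt (fun y : Fin d → ℝ => cvec y i)
        (ofRealCLM.comp (ContinuousLinearMap.proj (R := ℝ) (φ := fun _ : Fin d => ℝ) i)) x :=
      (ofRealCLM.comp
        (ContinuousLinearMap.proj (R := ℝ) (φ := fun _ : Fin d => ℝ) i)).hasFDerivAt
    have h := hp.mul hX
    simp only [map_mul, eval_X]
    refine h.congr_fderiv ?_
    ext v
    have hsplit : ∀ j, eval (cvec x) (pderiv j (p * X i)) =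
        (if i = j then eval (cvec x) p else 0) + cvec x i * eval (cvec x) (pderiv j p) := by
      intro j
      simp [Derivation.leibniz, pderiv_X, Pi.single_apply, apply_ite]
    simp [-Derivation.leibniz, hsplit, add_mul, Finset.sum_add_distrib, Finset.mul_sum, mul_assoc]

open MvPolynomial in
theorem grad_exp_mul_eval {d : ℕ} (c : ℂ) (E Q : MvPolynomial (Fin d) ℂ) (x : Fin d → ℝ)
    (j : Fin d) :
    grad (fun y => c * cexp (eval (cvec y) E) * eval (cvec y) Q) x j =
      c * cexp (eval (cvec x) E) *
        (eval (cvec x) (pderiv j E) * eval (cvec x) Q + eval (cvec x) (pderiv j Q)) := by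
  have h := ((hasFDerivAt_eval_cvec E x).cexp.const_mul c).mul (hasFDerivAt_eval_cvec Q x)
  unfold grad
  erw [h.fderiv]
  simp [Pi.single_apply, apply_ite]
  ring

theorem totalDegree_pderiv_le {σ R : Type*} [CommSemiring R] (i : σ) (p : MvPolynomial σ R) :
    (MvPolynomial.pderiv i p).totalDegree ≤ p.totalDegree := by
  refine Finset.sup_le fun m hm => ?_
  rw [MvPolynomial.mem_support_iff, MvPolynomial.coeff_pderiv] at hm
  have h := MvPolynomial.le_totalDegree (MvPolynomial.mem_support_iff.2 (left_ne_zero_of_mul hm))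
  rw [Finsupp.sum_add_index' (fun _ => rfl) (fun _ _ _ => rfl)] at h
  exact (Nat.le_add_right _ _).trans h

open MvPolynomial in
theorem linearForm_ne_zero {σ R : Type*} [Fintype σ] [CommSemiring R] {a : σ → R} (ha : a ≠ 0) :
    (∑ j, C (a j) * X j : MvPolynomial σ R) ≠ 0 := by
  classical
  intro h
  refine ha (funext fun i => ?_)
  have := congrArg (eval (Pi.single i 1)) h
  simpa [Pi.single_apply] using this

open MvPolynomial in
theorem totalDegree_linearForm {σ R : Type*} [Fintype σ] [CommSemiring R] {a : σ → R}
    (ha : a ≠ 0) : (∑ j, C (a j) * X j : MvPolynomial σ R).totalDegree = 1 :=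
  IsHomogeneous.totalDegree
    (IsHomogeneous.sum _ _ _ fun j _ => by
      simpa using (isHomogeneous_C σ (a j)).mul (isHomogeneous_X R j))
    (linearForm_ne_zero ha)

theorem cinner_mulVec_stdC {d : ℕ} (A : Matrix (Fin d) (Fin d) ℂ) (l : Fin d) (v : Fin d → ℂ) :
    cinner (A *ᵥ stdC l) v = (Aᴴ *ᵥ v) l := by
  simp [cinner, stdC, mulVec, dotProduct, Pi.single_apply]

/-- The exponent `-⟨x, M x⟩ / (2h)` as a polynomial. -/
def quadExponent {d : ℕ} (M : Matrix (Fin d) (Fin d) ℂ) (h : ℝ) : MvPolynomial (Fin d) ℂ :=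
  MvPolynomial.C (-(2 * (h : ℂ))⁻¹) *
    ∑ i, MvPolynomial.X i * ∑ j, MvPolynomial.C (M i j) * MvPolynomial.X j

theorem eval_quadExponent {d : ℕ} (M : Matrix (Fin d) (Fin d) ℂ) (h : ℝ) (x : Fin d → ℝ) :
    MvPolynomial.eval (cvec x) (quadExponent M h) =
      -(cinner (cvec x) (M *ᵥ cvec x) / ((2 * h : ℝ) : ℂ)) := by
  simp [quadExponent, cinner, mulVec, dotProduct, cvec, div_eq_mul_inv]
  ring

theorem eval_pderiv_quadExponent {d : ℕ} {M : Matrix (Fin d) (Fin d) ℂ} (hM : Mᵀ = M) {h : ℝ}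
    (x : Fin d → ℝ) (j : Fin d) :
    MvPolynomial.eval (cvec x) (MvPolynomial.pderiv j (quadExponent M h)) =
      -((h : ℂ)⁻¹ * (M *ᵥ cvec x) j) := by
  have hs : ∀ i k, M i k = M k i := fun i k => congrFun (congrFun hM k) i
  have hsum : ∑ i, cvec x i * M i j = (M *ᵥ cvec x) j := by
    simp only [mulVec, dotProduct, hs j]
    exact Finset.sum_congr rfl fun i _ => mul_comm _ _
  have hterm : ∀ i, MvPolynomial.eval (cvec x) (MvPolynomial.pderiv j
      (MvPolynomial.X i * ∑ k, MvPolynomial.C (M i k) * MvPolynomial.X k)) =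
      cvec x i * M i j + if i = j then (M *ᵥ cvec x) i else 0 := by
    intro i
    split_ifs with hij <;>
      simp [Derivation.leibniz, MvPolynomial.pderiv_X, Pi.single_apply, apply_ite, mulVec,
        dotProduct, hij]
  rw [quadExponent, MvPolynomial.pderiv_C_mul, map_mul, MvPolynomial.eval_C, map_sum, map_sum]
  simp only [hterm, Finset.sum_add_distrib, hsum, Finset.sum_ite_eq', Finset.mem_univ, if_true]
  rw [mul_inv]
  ring

theorem mul_inv_transpose_eq {d : ℕ} {A B : Matrix (Fin d) (Fin d) ℂ} (hA : IsUnit A.det)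
    (h : Aᵀ * B - Bᵀ * A = 0) : (B * A⁻¹)ᵀ = B * A⁻¹ := by
  have hAt : IsUnit Aᵀ.det := by rwa [det_transpose]
  have h' : Bᵀ = Aᵀ * (B * A⁻¹) := by
    rw [← Matrix.mul_assoc, sub_eq_zero.1 h, mul_nonsing_inv_cancel_right _ _ hA]
  rw [transpose_mul, transpose_nonsing_inv, h', nonsing_inv_mul_cancel_left _ _ hAt]

theorem conjTranspose_add_mul_inv {d : ℕ} {A B : Matrix (Fin d) (Fin d) ℂ} (hA : IsUnit A.det)
    (h : Aᴴ * B + Bᴴ * A = (2 : ℂ) • (1 : Matrix (Fin d) (Fin d) ℂ)) :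
    Bᴴ + Aᴴ * (B * A⁻¹) = (2 : ℂ) • A⁻¹ := by
  rw [← one_mul A⁻¹, ← smul_mul_assoc, ← h, add_mul, mul_nonsing_inv_cancel_right _ _ hA,
    one_mul, Matrix.mul_assoc, add_comm]

/-- The action of `√(2h) R_l` on the polynomial factor of a Gaussian times a polynomial. -/
def raisePoly {d : ℕ} (A : Matrix (Fin d) (Fin d) ℂ) (h : ℝ) (l : Fin d)
    (Q : MvPolynomial (Fin d) ℂ) : MvPolynomial (Fin d) ℂ :=
  (∑ j, MvPolynomial.C (((2 : ℂ) • A⁻¹) l j) * MvPolynomial.X j) * Q -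
    MvPolynomial.C (h : ℂ) * ∑ j, MvPolynomial.C (Aᴴ l j) * MvPolynomial.pderiv j Q

theorem totalDegree_raisePoly {d : ℕ} {A : Matrix (Fin d) (Fin d) ℂ} (hA : IsUnit A.det) (h : ℝ)
    (l : Fin d) {Q : MvPolynomial (Fin d) ℂ} (hQ : Q ≠ 0) :
    (raisePoly A h l Q).totalDegree = Q.totalDegree + 1 := by
  have ha : (fun j => ((2 : ℂ) • A⁻¹) l j) ≠ 0 := by
    intro h0
    have h1 := congrFun (congrFun (nonsing_inv_mul A hA) l) l
    have h2 : ∀ j, A⁻¹ l j = 0 := fun j => by simpa using congrFun h0 j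
    simp [Matrix.mul_apply, h2] at h1
  have hlead := MvPolynomial.totalDegree_mul_of_isDomain (linearForm_ne_zero ha) hQ
  rw [totalDegree_linearForm ha] at hlead
  have hlow : (-(MvPolynomial.C (h : ℂ) *
      ∑ j, MvPolynomial.C (Aᴴ l j) * MvPolynomial.pderiv j Q)).totalDegree ≤ Q.totalDegree := by
    rw [MvPolynomial.totalDegree_neg, ← MvPolynomial.smul_eq_C_mul]
    refine (MvPolynomial.totalDegree_smul_le _ _).trans
      (MvPolynomial.totalDegree_finsetSum_le fun j _ => ?_)
    rw [← MvPolynomial.smul_eq_C_mul]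
    exact (MvPolynomial.totalDegree_smul_le _ _).trans (totalDegree_pderiv_le j Q)
  rw [raisePoly, sub_eq_add_neg, MvPolynomial.totalDegree_add_eq_left_of_totalDegree_lt, hlead,
    add_comm]
  omega

theorem raiseOp_phi0_mul_eval {d : ℕ} {h : ℝ} (hh : 0 < h) {A B : Matrix (Fin d) (Fin d) ℂ}
    (hA : IsUnit A.det) (hAB₁ : Aᴴ * B + Bᴴ * A = (2 : ℂ) • (1 : Matrix (Fin d) (Fin d) ℂ))
    (hAB₂ : Aᵀ * B - Bᵀ * A = 0) (s : ℂ) (l : Fin d) (Q : MvPolynomial (Fin d) ℂ) :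
    raiseOp A B h l (fun x => phi0 A B h s x * MvPolynomial.eval (cvec x) Q) = fun x =>
      phi0 A B h s x * MvPolynomial.eval (cvec x)
        (MvPolynomial.C ((Real.sqrt (2 * h) : ℝ) : ℂ)⁻¹ * raisePoly A h l Q) := by
  have hh' : (h : ℂ) ≠ 0 := by exact_mod_cast hh.ne'
  funext x
  have hgrad : grad (fun y => phi0 A B h s y * MvPolynomial.eval (cvec y) Q) x =
      phi0 A B h s x • (-((h : ℂ)⁻¹ * MvPolynomial.eval (cvec x) Q) • (B * A⁻¹) *ᵥ cvec x +
        fun j => MvPolynomial.eval (cvec x) (MvPolynomial.pderiv j Q)) := by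
    funext j
    simp only [phi0, ← eval_quadExponent, grad_exp_mul_eval,
      eval_pderiv_quadExponent (mul_inv_transpose_eq hA hAB₂), Pi.smul_apply, Pi.add_apply,
      smul_eq_mul]
    ring
  have hlin := congrFun (congrArg (· *ᵥ cvec x) (conjTranspose_add_mul_inv hA hAB₁)) l
  simp only [add_mulVec, Pi.add_apply, ← mulVec_mulVec] at hlin
  simp only [raiseOp, hgrad, cinner_mulVec_stdC, mulVec_smul, mulVec_add, Pi.smul_apply,
    Pi.add_apply, smul_eq_mul, map_mul, MvPolynomial.eval_C, raisePoly, map_sub, map_sum,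
    MvPolynomial.eval_X]
  rw [show ∑ j, ((2 : ℂ) • A⁻¹) l j * cvec x j = (((2 : ℂ) • A⁻¹) *ᵥ cvec x) l from rfl,
    ← hlin, ← mulVec_mulVec]
  simp only [mulVec, dotProduct]
  field_simp
  ring

theorem phi0_ne_zero {d : ℕ} {h : ℝ} (hh : 0 < h) (A B : Matrix (Fin d) (Fin d) ℂ) {s : ℂ}
    (hs : s ≠ 0) (x : Fin d → ℝ) : phi0 A B h s x ≠ 0 := by
  have hpos : 0 < Real.pi ^ (-(d : ℝ) / 4) * h ^ (-(d : ℝ) / 4) := by positivity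
  exact mul_ne_zero (mul_ne_zero (ofReal_ne_zero.2 hpos.ne') (inv_ne_zero hs)) (exp_ne_zero _)

theorem opPow_induction {d : ℕ} {α : Type*} {R : Fin d → α → α} {P : ℕ → α → Prop}
    (hR : ∀ l n a, P n a → P (n + 1) (R l a)) (k : Fin d → ℕ) {a : α} (ha : P 0 a) :
    P (∑ l, k l) (opPow R k a) := by
  have hiter : ∀ l m n b, P n b → P (m + n) ((R l)^[m] b) := by
    intro l m n b hb
    induction m with
    | zero => simpa using hb
    | succ m ih =>
      rw [Function.iterate_succ_apply', Nat.add_right_comm]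
      exact hR _ _ _ ih
  rw [Fin.sum_univ_def, opPow]
  induction List.finRange d with
  | nil => simpa using ha
  | cons l L ih => simpa using hiter l (k l) _ _ ih

/-- For every multi-index `k`, the function
`x ↦ 2^(|k|/2) (R_1^(k_1) ∘ ⋯ ∘ R_d^(k_d) φ₀)(x) / φ₀(x)` is (the restriction to `ℝ^d`
of) a polynomial of degree `|k|` with complex coefficients. -/
theorem Ppoly_is_polynomial_of_degree
    {d : ℕ} (hd : 1 ≤ d) {hbar : ℝ} (hhbar : 0 < hbar)
    (A B : Matrix (Fin d) (Fin d) ℂ) (hA : IsUnit A.det) (hB : IsUnit B.det)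
    (hAB₁ : Aᴴ * B + Bᴴ * A = (2 : ℂ) • (1 : Matrix (Fin d) (Fin d) ℂ))
    (hAB₂ : Aᵀ * B - Bᵀ * A = 0)
    (sqrtA : ℂ) (hsqrtA : sqrtA ^ 2 = A.det)
    (k : Fin d → ℕ) :
    ∃ Q : MvPolynomial (Fin d) ℂ, Q.totalDegree = ∑ l, k l ∧
      ∀ x : Fin d → ℝ, Ppoly A B hbar sqrtA k x = MvPolynomial.eval (cvec x) Q := by
  have hs : sqrtA ≠ 0 := by
    rintro rfl
    exact hA.ne_zero (by simpa using hsqrtA.symm)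
  have hc : ((Real.sqrt (2 * hbar) : ℝ) : ℂ)⁻¹ ≠ 0 :=
    inv_ne_zero (ofReal_ne_zero.2 (Real.sqrt_pos.2 (by positivity)).ne')
  obtain ⟨Q, hQ, hdeg, heq⟩ := opPow_induction (R := raiseOp A B hbar)
    (P := fun n ψ => ∃ Q : MvPolynomial (Fin d) ℂ, Q ≠ 0 ∧ Q.totalDegree = n ∧
      ψ = fun x => phi0 A B hbar sqrtA x * MvPolynomial.eval (cvec x) Q)
    (by
      rintro l n _ ⟨Q, hQ, hdeg, rfl⟩
      have hd := totalDegree_raisePoly hA hbar l hQ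
      have hne : raisePoly A hbar l Q ≠ 0 := by
        intro h0
        simp [h0] at hd
      refine ⟨_, mul_ne_zero (MvPolynomial.C_ne_zero.2 hc) hne, ?_,
        raiseOp_phi0_mul_eval hhbar hA hAB₁ hAB₂ sqrtA l Q⟩
      rw [MvPolynomial.totalDegree_mul_of_isDomain (MvPolynomial.C_ne_zero.2 hc) hne,
        MvPolynomial.totalDegree_C, hd, hdeg, zero_add])
    k (a := phi0 A B hbar sqrtA) ⟨1, one_ne_zero, MvPolynomial.totalDegree_one, by simp⟩
  have h2 : (((2 : ℝ) ^ (((∑ l, k l : ℕ) : ℝ) / 2) : ℝ) : ℂ) ≠ 0 :=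
    ofReal_ne_zero.2 (by positivity)
  refine ⟨MvPolynomial.C (((2 : ℝ) ^ (((∑ l, k l : ℕ) : ℝ) / 2) : ℝ) : ℂ) * Q, ?_, fun x => ?_⟩
  · rw [MvPolynomial.totalDegree_mul_of_isDomain (MvPolynomial.C_ne_zero.2 h2) hQ,
      MvPolynomial.totalDegree_C, hdeg, zero_add]
  · have hφ := phi0_ne_zero hhbar A B hs x
    rw [Ppoly, heq, map_mul, MvPolynomial.eval_C]
    field_simp

end
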